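/- Let n ≥ 1. The family of products { Ê_{p_1}^1 · Ê_{p_2}^2 · ⋯ · Ê_{p_{n−1}}^{n−1} : 0 ≤ p_i ≤ i for i = 1, …, n−1 }, viewed in R[x_1, …, x_{n−1}] via the canonical map ℤ[q_1, …, q_{n−1}] → R, is an R-basis of the R-submodule L_n^R of R[x_1, …, x_{n−1}] freely spanned by the monomials x_1^{i_1}·⋯·x_{n−1}^{i_{n−1}} with 0 ≤ i_j ≤ n−j for all j. -/

import Mathlib

open MvPolynomial Finset

noncomputable section

set_option maxHeartbeats 1000000

/-- The polynomial ring `ℤ[q_1, …, q_{n−1}]`; the variable `i : Fin (n−1)` is `q_{i+1}`. -/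
abbrev QPoly (n : ℕ) := MvPolynomial (Fin (n - 1)) ℤ

/-- The multiplicative set generated by the elements `1 − q_i`. -/
def qSubmonoid (n : ℕ) : Submonoid (QPoly n) :=
  Submonoid.closure (Set.range fun i : Fin (n - 1) => 1 - MvPolynomial.X i)

/-- `R = ℤ[q_1, …, q_{n−1}][(1−q_1)⁻¹, …, (1−q_{n−1})⁻¹]`. -/
abbrev QRing (n : ℕ) := Localization (qSubmonoid n)

/-- The polynomial ring `R[x_1, …, x_{n−1}]`; the variable `i : Fin (n−1)` is `x_{i+1}`. -/
abbrev PolyR (n : ℕ) := MvPolynomial (Fin (n - 1)) (QRing n)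

/-- The image of `q_{i+1}` in `R[x_1, …, x_{n−1}]` under the canonical map. -/
def qC (n : ℕ) (i : Fin (n - 1)) : PolyR n :=
  C (algebraMap (QPoly n) (QRing n) (MvPolynomial.X i))

/-- The polynomial `F_p^k` viewed in `R[x_1, …, x_{n−1}]` (for `0 ≤ p ≤ k ≤ n−1`);
the index `i : Fin (n−1)` corresponds to the `1`-based position `i+1 ∈ {1, …, k}`. -/
def FR (n : ℕ) (p k : ℕ) : PolyR n :=
  if p ≤ k then
    ∑ I ∈ ((Finset.univ : Finset (Fin (n - 1))).filter fun i : Fin (n - 1) => (i : ℕ) < k).powersetCard p,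
      (∏ i ∈ I, (1 - X i)) *
        ∏ i ∈ I.filter (fun i : Fin (n - 1) => ¬ ∃ j ∈ I, (j : ℕ) = (i : ℕ) + 1), (1 - qC n i)
  else 0

/-- The `R`-submodule `L_n^R` of `R[x_1, …, x_{n−1}]` spanned by the monomials
`x_1^{i_1}⋯x_{n−1}^{i_{n−1}}` with `0 ≤ i_j ≤ n−j`. -/
def Lmod (n : ℕ) : Submodule (QRing n) (PolyR n) :=
  Submodule.span (QRing n)
    {m : PolyR n | ∃ α : Fin (n - 1) → ℕ,
      (∀ i : Fin (n - 1), α i + ((i : ℕ) + 1) ≤ n) ∧ m = ∏ i : Fin (n - 1), X i ^ α i}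

/-- The polynomial `Ê_p^k = Σ_{i=0}^p (−1)^i C(k−i, p−i) F_i^k` viewed in
`R[x_1, …, x_{n−1}]`. -/
def ER (n : ℕ) (p k : ℕ) : PolyR n :=
  if p ≤ k then
    ∑ i ∈ Finset.range (p + 1),
      (-1 : PolyR n) ^ i * (Nat.choose (k - i) (p - i) : PolyR n) * FR n i k
  else 0

/-- The family of products `Ê_{p_1}^1·Ê_{p_2}^2·⋯·Ê_{p_{n−1}}^{n−1}` with `0 ≤ p_i ≤ i`. -/
def famE (n : ℕ) (p : (i : Fin (n - 1)) → Fin ((i : ℕ) + 2)) : PolyR n :=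
  ∏ i : Fin (n - 1), ER n (p i) ((i : ℕ) + 1)

section WeightedElementarySymmetric

variable {R A σ : Type*} [CommRing R] [CommRing A] [Algebra R A]

/-- The elementary symmetric sum of degree `p` in the `y i`, `i ∈ S`, in which the product over
`I ⊆ S` carries the weight `w I`. -/
def weightedEsymm (w : Finset σ → R) (y : σ → A) (S : Finset σ) (p : ℕ) : A :=
  ∑ I ∈ S.powersetCard p, w I • ∏ i ∈ I, y i

/-- The span of the powers `a ^ e` with `e ≤ d`. -/
def powSpan (R : Type*) {A : Type*} [CommRing R] [CommRing A] [Algebra R A] (a : A) (d : ℕ) :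
    Submodule R A :=
  Submodule.span R {z | ∃ e ≤ d, z = a ^ e}

lemma weightedEsymm_card (w : Finset σ → R) (y : σ → A) (S : Finset σ) :
    weightedEsymm w y S #S = w S • ∏ i ∈ S, y i := by
  simp [weightedEsymm, Finset.powersetCard_self]

lemma prod_powSpan (y : σ → A) (S : Finset σ) (d : σ → ℕ) :
    ∏ i ∈ S, powSpan R (y i) (d i) =
      Submodule.span R {z | ∃ α : σ → ℕ, (∀ i ∈ S, α i ≤ d i) ∧ z = ∏ i ∈ S, y i ^ α i} := by
  classical
  simp only [powSpan]
  rw [Submodule.prod_span]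
  congr 1
  ext z
  rw [Set.mem_finsetProd]
  constructor
  · rintro ⟨g, hg, rfl⟩
    have hg' : ∀ i ∈ S, ∃ e ≤ d i, g i = y i ^ e := fun i hi => hg hi
    choose! e he h using hg'
    exact ⟨e, he, Finset.prod_congr rfl h⟩
  · rintro ⟨α, hα, rfl⟩
    exact ⟨fun i => y i ^ α i, fun hi => ⟨_, hα _ hi, rfl⟩, rfl⟩

lemma powSpan_mul_powSpan_le (a : A) (d e : ℕ) :
    powSpan R a d * powSpan R a e ≤ powSpan R a (d + e) := by
  rw [powSpan, powSpan, Submodule.span_mul_span, Submodule.span_le]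
  rintro _ ⟨_, ⟨b, hb, rfl⟩, _, ⟨c, hc, rfl⟩, rfl⟩
  exact Submodule.subset_span ⟨b + c, by omega, (pow_add a b c).symm⟩

lemma powSpan_zero (a : A) : powSpan R a 0 = 1 := by
  simp [powSpan, Submodule.one_eq_span]

lemma powSpan_one_sub_le (a : A) (d : ℕ) : powSpan R (1 - a) d ≤ powSpan R a d := by
  rw [powSpan, Submodule.span_le]
  rintro _ ⟨e, he, rfl⟩
  rw [SetLike.mem_coe, sub_eq_neg_add, add_pow]
  refine Submodule.sum_mem _ fun j hj => ?_
  have hj' : j ≤ d := by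
    have := Finset.mem_range.1 hj
    omega
  have : (-a) ^ j * 1 ^ (e - j) * ((e.choose j : ℕ) : A) =
      ((-1) ^ j * (e.choose j : R)) • a ^ j := by
    rw [neg_pow, one_pow, mul_one, Algebra.smul_def]
    simp only [map_mul, map_pow, map_neg, map_one, map_natCast]
    ring
  rw [this]
  exact Submodule.smul_mem _ _ (Submodule.subset_span ⟨j, hj', rfl⟩)

lemma powSpan_one_sub (a : A) (d : ℕ) : powSpan R (1 - a) d = powSpan R a d :=
  le_antisymm (powSpan_one_sub_le a d) (by simpa using powSpan_one_sub_le (R := R) (1 - a) d)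

variable [LinearOrder σ]

lemma weightedEsymm_eq_erase_add (w : Finset σ → R) (y : σ → A) (S : Finset σ) (i : σ) (p : ℕ) :
    weightedEsymm w y S p = weightedEsymm w y (S.erase i) p +
      ∑ I ∈ S.powersetCard p with i ∈ I, w I • ∏ j ∈ I, y j := by
  rw [weightedEsymm, ← Finset.sum_filter_not_add_sum_filter _ (fun I => i ∈ I), weightedEsymm]
  congr 2
  ext I
  simp only [Finset.mem_filter, Finset.mem_powersetCard, Finset.subset_erase]
  tauto

lemma prod_pow_mul_prod_subset (y : σ → A) {I S : Finset σ} (h : I ⊆ S) (m : σ → ℕ) :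
    (∏ i ∈ S, y i ^ m i) * ∏ i ∈ I, y i = ∏ i ∈ S, y i ^ (m i + if i ∈ I then 1 else 0) := by
  simp_rw [pow_add, Finset.prod_mul_distrib, pow_ite, pow_one, pow_zero]
  rw [Finset.prod_ite_mem, Finset.inter_eq_right.2 h]

/-- The products of a monomial in the `y i` whose exponent at `i ∈ S` is at most the number of
elements of `S` above `i` with a weighted elementary symmetric sum over `S`. -/
def monomialMulEsymm (w : Finset σ → R) (y : σ → A) (S : Finset σ) : Set A :=
  {z | ∃ (m : σ → ℕ) (p : ℕ), (∀ i ∈ S, m i ≤ #{j ∈ S | i < j}) ∧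
    z = (∏ i ∈ S, y i ^ m i) * weightedEsymm w y S p}

lemma card_filter_le_eq {S : Finset σ} {i : σ} (hi : i ∈ S) :
    #{j ∈ S | i ≤ j} = #{j ∈ S | i < j} + 1 := by
  have : ({j ∈ S | i ≤ j} : Finset σ) = insert i {j ∈ S | i < j} := by
    ext j
    simp only [Finset.mem_filter, Finset.mem_insert, le_iff_eq_or_lt]
    aesop
  rw [this, Finset.card_insert_of_notMem (by simp)]

lemma card_filter_erase_of_pos {S : Finset σ} {i : σ} (hi : i ∈ S) (P : σ → Prop)
    [DecidablePred P] (h : P i) : #{j ∈ S | P j} = #{j ∈ S.erase i | P j} + 1 := by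
  rw [Finset.filter_erase, Finset.card_erase_add_one (by simp [hi, h])]

lemma filter_erase_of_neg {S : Finset σ} {i : σ} (P : σ → Prop)
    [DecidablePred P] (h : ¬ P i) : ({j ∈ S.erase i | P j} : Finset σ) = {j ∈ S | P j} := by
  rw [Finset.filter_erase, Finset.erase_eq_of_notMem (by simp [h])]

theorem prod_pow_mem_span_monomialMulEsymm {w : Finset σ → R} (hw : ∀ I, IsUnit (w I))
    (y : σ → A) (S : Finset σ) (α : σ → ℕ) (hα : ∀ i ∈ S, α i ≤ #{j ∈ S | i ≤ j}) :
    ∏ i ∈ S, y i ^ α i ∈ Submodule.span R (monomialMulEsymm w y S) := by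
  induction S using Finset.strongInduction generalizing α with
  | H S ihS =>
  induction hd : #{i ∈ S | ∃ j ∈ S, j ≤ i ∧ α j = 0} using Nat.strong_induction_on
    generalizing α with
  | _ d ihd =>
  by_cases hpos : ∀ i ∈ S, α i ≠ 0
  · obtain ⟨u, hu⟩ := hw S
    have key : ∏ i ∈ S, y i ^ α i =
        (↑u⁻¹ : R) • ((∏ i ∈ S, y i ^ (α i - 1)) * weightedEsymm w y S #S) := by
      rw [weightedEsymm_card, mul_smul_comm, smul_smul, ← hu, Units.inv_mul, one_smul,
        ← Finset.prod_mul_distrib]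
      refine Finset.prod_congr rfl fun i hi => ?_
      rw [← pow_succ, Nat.sub_add_cancel (Nat.pos_of_ne_zero (hpos i hi))]
    rw [key]
    refine Submodule.smul_mem _ _ (Submodule.subset_span ⟨_, _, fun i hi => ?_, rfl⟩)
    have := hα i hi
    rw [card_filter_le_eq hi] at this
    omega
  · push Not at hpos
    obtain ⟨i, hi, hmin⟩ : ∃ i ∈ ({j ∈ S | α j = 0} : Finset σ),
        ∀ j ∈ ({j ∈ S | α j = 0} : Finset σ), i ≤ j := by
      have hne : ({j ∈ S | α j = 0} : Finset σ).Nonempty := by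
        obtain ⟨i, hi, h0⟩ := hpos
        exact ⟨i, by simp [hi, h0]⟩
      exact ⟨_, Finset.min'_mem _ hne, fun j hj => Finset.min'_le _ j hj⟩
    obtain ⟨hiS, hi0⟩ := Finset.mem_filter.1 hi
    have hlt : ∀ j ∈ S, j < i → α j ≠ 0 := fun j hj hji h0 =>
      (hmin j (by simp [hj, h0])).not_gt hji
    have ih := ihS (S.erase i) (Finset.erase_ssubset hiS)
      (fun j => if j < i then α j - 1 else α j) (by
        intro j hj
        obtain ⟨hji, hjS⟩ := Finset.mem_erase.1 hj
        have h := hα j hjS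
        rcases lt_or_gt_of_ne hji with h' | h'
        · rw [card_filter_erase_of_pos hiS _ h'.le] at h
          simp only [h', if_true]
          omega
        · rw [filter_erase_of_neg _ h'.not_ge]
          simpa [h'.not_gt] using h)
    set c : A := ∏ j ∈ S.erase i, y j ^ (if j < i then 1 else 0) with hc
    have hprod : ∏ j ∈ S, y j ^ α j =
        c * ∏ j ∈ S.erase i, y j ^ (if j < i then α j - 1 else α j) := by
      rw [hc, ← Finset.prod_mul_distrib, ← Finset.mul_prod_erase _ _ hiS, hi0, pow_zero, one_mul]
      refine Finset.prod_congr rfl fun j hj => ?_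
      rw [← pow_add]
      congr 1
      split_ifs with hji
      · have := hlt j (Finset.mem_of_mem_erase hj) hji
        omega
      · simp
    have hle : Submodule.span R (monomialMulEsymm w y (S.erase i)) ≤
        (Submodule.span R (monomialMulEsymm w y S)).comap (LinearMap.mulLeft R c) := by
      rw [Submodule.span_le]
      rintro _ ⟨m', p, hm', rfl⟩
      set m : σ → ℕ := fun j => if j = i then 0 else m' j + if j < i then 1 else 0 with hm
      have hmS : ∀ j ∈ S, m j ≤ #{k ∈ S | j < k} := by
        intro j hj
        by_cases hji : j = i
        · simp [hm, hji]
        have h := hm' j (Finset.mem_erase.2 ⟨hji, hj⟩)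
        rcases lt_or_gt_of_ne hji with h' | h'
        · rw [card_filter_erase_of_pos hiS _ h']
          simp only [hm, hji, h', if_true, if_false]
          omega
        · rw [filter_erase_of_neg _ h'.not_gt] at h
          simpa [hm, hji, h'.not_gt] using h
      have hcm : c * ∏ j ∈ S.erase i, y j ^ m' j = ∏ j ∈ S, y j ^ m j := by
        rw [hc, ← Finset.prod_mul_distrib, ← Finset.mul_prod_erase _ _ hiS]
        simp only [hm, if_true, pow_zero, one_mul]
        refine Finset.prod_congr rfl fun j hj => ?_
        rw [← pow_add, if_neg (Finset.ne_of_mem_erase hj), add_comm]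
      have hexp : c * ((∏ j ∈ S.erase i, y j ^ m' j) * weightedEsymm w y (S.erase i) p) =
          (∏ j ∈ S, y j ^ m j) * weightedEsymm w y S p -
            ∑ I ∈ S.powersetCard p with i ∈ I,
              w I • ∏ j ∈ S, y j ^ (m j + if j ∈ I then 1 else 0) := by
        rw [weightedEsymm_eq_erase_add w y S i, ← mul_assoc, hcm, mul_add, Finset.mul_sum,
          eq_sub_iff_add_eq]
        congr 1
        refine Finset.sum_congr rfl fun I hI => ?_
        rw [mul_smul_comm, prod_pow_mul_prod_subset y
          (Finset.mem_powersetCard.1 (Finset.mem_filter.1 hI).1).1]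
      rw [SetLike.mem_coe, Submodule.mem_comap, LinearMap.mulLeft_apply, hexp]
      refine Submodule.sub_mem _ (Submodule.subset_span ⟨m, p, hmS, rfl⟩)
        (Submodule.sum_mem _ fun I hI => Submodule.smul_mem _ _ ?_)
      have hiI : i ∈ I := (Finset.mem_filter.1 hI).2
      refine ihd _ ?_ _ ?_ rfl
      · rw [← hd]
        refine Finset.card_lt_card (Finset.ssubset_iff_of_subset ?_ |>.2 ⟨i, ?_, ?_⟩)
        · intro j hj
          simp only [Finset.mem_filter] at hj ⊢
          obtain ⟨hjS, k, hkS, hkj, hk⟩ := hj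
          refine ⟨hjS, i, hiS, le_trans ?_ hkj, hi0⟩
          by_contra! hki
          simp [hm, hki, hki.ne] at hk
        · simp only [Finset.mem_filter]
          exact ⟨hiS, i, hiS, le_rfl, hi0⟩
        · simp only [Finset.mem_filter, not_and, not_exists]
          intro _ k _ hki hk
          rcases hki.lt_or_eq with h' | rfl
          · simp [hm, h', h'.ne] at hk
          · simp [hiI] at hk
      · intro j hj
        rw [card_filter_le_eq hj]
        have := hmS j hj
        split_ifs <;> omega
    rw [hprod]
    exact hle ih

lemma weightedEsymm_mem_prod_powSpan (w : Finset σ → R) (y : σ → A) (S : Finset σ) (p : ℕ) :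
    weightedEsymm w y S p ∈ ∏ i ∈ S, powSpan R (y i) 1 := by
  rw [prod_powSpan]
  refine Submodule.sum_mem _ fun I hI => Submodule.smul_mem _ _ (Submodule.subset_span
    ⟨fun i => if i ∈ I then 1 else 0, fun i _ => by dsimp only; split_ifs <;> simp, ?_⟩)
  have := prod_pow_mul_prod_subset y (Finset.mem_powersetCard.1 hI).1 0
  simpa using this

theorem prod_powSpan_mul_span_weightedEsymm {w : Finset σ → R} (hw : ∀ I, IsUnit (w I))
    (y : σ → A) (S : Finset σ) :
    (∏ i ∈ S, powSpan R (y i) #{j ∈ S | i < j}) *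
        Submodule.span R (Set.range (weightedEsymm w y S)) =
      ∏ i ∈ S, powSpan R (y i) #{j ∈ S | i ≤ j} := by
  apply le_antisymm
  · calc _ ≤ (∏ i ∈ S, powSpan R (y i) #{j ∈ S | i < j}) * ∏ i ∈ S, powSpan R (y i) 1 := by
          gcongr
          rw [Submodule.span_le]
          rintro _ ⟨p, rfl⟩
          exact weightedEsymm_mem_prod_powSpan w y S p
      _ = ∏ i ∈ S, powSpan R (y i) #{j ∈ S | i < j} * powSpan R (y i) 1 :=
          Finset.prod_mul_distrib.symm
      _ ≤ _ := by
          refine Finset.prod_le_prod' fun i hi => ?_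
          rw [card_filter_le_eq hi]
          exact powSpan_mul_powSpan_le _ _ _
  · rw [prod_powSpan, prod_powSpan, Submodule.span_mul_span, Submodule.span_le]
    rintro _ ⟨α, hα, rfl⟩
    refine Submodule.span_mono ?_ (prod_pow_mem_span_monomialMulEsymm hw y S α hα)
    rintro _ ⟨m, p, hm, rfl⟩
    exact Set.mul_mem_mul ⟨m, hm, rfl⟩ ⟨p, rfl⟩

end WeightedElementarySymmetric

section InitialSegment

variable {N : ℕ}

/-- The first `k` elements of `Fin N`. -/
def initialSegment (N k : ℕ) : Finset (Fin N) := {i | (i : ℕ) < k}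

lemma mem_initialSegment {k : ℕ} {i : Fin N} : i ∈ initialSegment N k ↔ (i : ℕ) < k := by
  simp [initialSegment]

lemma initialSegment_succ {k : ℕ} (hk : k < N) :
    initialSegment N (k + 1) = insert ⟨k, hk⟩ (initialSegment N k) := by
  ext i
  simp only [mem_initialSegment, Finset.mem_insert, Fin.ext_iff]
  omega

lemma card_initialSegment_le (k : ℕ) : #(initialSegment N k) ≤ k := by
  rw [← Finset.card_image_of_injective _ Fin.val_injective]
  refine (Finset.card_le_card (t := Finset.range k) ?_).trans_eq (Finset.card_range k)
  intro a
  simp only [Finset.mem_image, mem_initialSegment, Finset.mem_range]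
  rintro ⟨i, hi, rfl⟩
  exact hi

lemma card_filter_initialSegment {k : ℕ} (hk : k ≤ N) (i : Fin N) :
    #{j ∈ initialSegment N k | i ≤ j} = k - i := by
  rw [← Finset.card_image_of_injective _ Fin.val_injective, ← Nat.card_Ico]
  congr 1
  ext a
  simp only [Finset.mem_image, Finset.mem_filter, mem_initialSegment, Finset.mem_Ico]
  constructor
  · rintro ⟨j, ⟨hj, hij⟩, rfl⟩
    exact ⟨hij, hj⟩
  · rintro ⟨h1, h2⟩
    exact ⟨⟨a, h2.trans_le hk⟩, ⟨h2, h1⟩, rfl⟩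

theorem prod_span_weightedEsymm_initialSegment {R A : Type*} [CommRing R] [CommRing A]
    [Algebra R A] {w : Finset (Fin N) → R} (hw : ∀ I, IsUnit (w I)) (y : Fin N → A) {k : ℕ}
    (hk : k ≤ N) :
    ∏ i ∈ initialSegment N k,
        Submodule.span R (Set.range (weightedEsymm w y (initialSegment N ((i : ℕ) + 1)))) =
      ∏ i ∈ initialSegment N k, powSpan R (y i) (k - i) := by
  induction k with
  | zero => simp [initialSegment]
  | succ k ih =>
    have hnot : (⟨k, hk⟩ : Fin N) ∉ initialSegment N k := by simp [mem_initialSegment]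
    calc _ = (∏ i ∈ initialSegment N k, powSpan R (y i) (k - i)) *
            Submodule.span R (Set.range (weightedEsymm w y (initialSegment N (k + 1)))) := by
          rw [initialSegment_succ hk, Finset.prod_insert hnot, ih (by omega), mul_comm,
            initialSegment_succ hk]
      _ = (∏ i ∈ initialSegment N (k + 1),
              powSpan R (y i) #{j ∈ initialSegment N (k + 1) | i < j}) *
            Submodule.span R (Set.range (weightedEsymm w y (initialSegment N (k + 1)))) := by
          congr 1
          have : ∀ i ∈ initialSegment N (k + 1),
              powSpan R (y i) #{j ∈ initialSegment N (k + 1) | i < j} =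
                powSpan R (y i) (k - i) := by
            intro i hi
            congr 1
            have h := card_filter_initialSegment hk i
            rw [card_filter_le_eq hi] at h
            omega
          rw [Finset.prod_congr rfl this, initialSegment_succ hk, Finset.prod_insert hnot]
          simp [powSpan_zero]
      _ = ∏ i ∈ initialSegment N (k + 1), powSpan R (y i) (k + 1 - i) := by
          rw [prod_powSpan_mul_span_weightedEsymm hw]
          simp_rw [card_filter_initialSegment hk]

end InitialSegment

lemma isUnit_one_sub_q (n : ℕ) (i : Fin (n - 1)) :
    IsUnit (1 - algebraMap (QPoly n) (QRing n) (X i)) := by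
  rw [← map_one (algebraMap (QPoly n) (QRing n)), ← map_sub]
  exact IsLocalization.map_units (QRing n)
    (⟨1 - X i, Submonoid.subset_closure ⟨i, rfl⟩⟩ : qSubmonoid n)

instance nontrivial_QRing (n : ℕ) : Nontrivial (QRing n) := by
  have h : qSubmonoid n ≤
      (IsUnit.submonoid ℤ).comap (MvPolynomial.eval (0 : Fin (n - 1) → ℤ)) := by
    rw [qSubmonoid, Submonoid.closure_le]
    rintro _ ⟨i, rfl⟩
    simp
  exact (IsLocalization.lift (S := QRing n) fun y : qSubmonoid n => h y.2).domain_nontrivial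

/-- The weight `∏ (1 - q_i)` over `i ∈ I` with `i + 1 ∉ I`. -/
def qWeight (n : ℕ) (I : Finset (Fin (n - 1))) : QRing n :=
  ∏ i ∈ I.filter (fun i : Fin (n - 1) => ¬ ∃ j ∈ I, (j : ℕ) = (i : ℕ) + 1),
    (1 - algebraMap (QPoly n) (QRing n) (X i))

lemma isUnit_qWeight (n : ℕ) (I : Finset (Fin (n - 1))) : IsUnit (qWeight n I) :=
  (IsUnit.prod_iff).2 fun i _ => isUnit_one_sub_q n i

lemma FR_eq_weightedEsymm (n p k : ℕ) :
    FR n p k = weightedEsymm (qWeight n) (fun i => (1 - X i : PolyR n))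
      (initialSegment (n - 1) k) p := by
  unfold FR
  split_ifs with h
  · refine Finset.sum_congr rfl fun I _ => ?_
    rw [Algebra.smul_def, mul_comm, MvPolynomial.algebraMap_eq, qWeight, map_prod]
    simp [qC]
  · rw [weightedEsymm, Finset.powersetCard_eq_empty.2, Finset.sum_empty]
    exact (card_initialSegment_le k).trans_lt (not_le.1 h)

/-- The alternating binomial sums of `f` have the same span as `f`, as the transition matrix is
triangular with diagonal entries `(-1) ^ p`. -/
lemma span_range_alternating_choose_sum {R A : Type*} [CommRing R] [CommRing A] [Algebra R A]
    (k : ℕ) (f e : ℕ → A) (hf : ∀ p, k < p → f p = 0) (he : ∀ p, k < p → e p = 0)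
    (hef : ∀ p ≤ k, e p = ∑ i ∈ Finset.range (p + 1),
      (-1 : A) ^ i * (Nat.choose (k - i) (p - i) : A) * f i) :
    Submodule.span R (Set.range e) = Submodule.span R (Set.range f) := by
  have hcoef : ∀ p i, (-1 : A) ^ i * (Nat.choose (k - i) (p - i) : A) * f i =
      ((-1 : R) ^ i * (Nat.choose (k - i) (p - i) : R)) • f i := fun p i => by
    simp [Algebra.smul_def]
  apply le_antisymm <;> rw [Submodule.span_le] <;> rintro _ ⟨p, rfl⟩ <;> rw [SetLike.mem_coe]
  · rcases le_or_gt p k with hp | hp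
    · rw [hef p hp]
      simp_rw [hcoef p]
      exact Submodule.sum_mem _ fun i _ =>
        Submodule.smul_mem _ _ (Submodule.subset_span ⟨i, rfl⟩)
    · rw [he p hp]
      exact Submodule.zero_mem _
  · induction p using Nat.strong_induction_on with
    | _ p ih =>
    rcases le_or_gt p k with hp | hp
    · have hsum := hef p hp
      simp_rw [hcoef p] at hsum
      rw [Finset.sum_range_succ, Nat.sub_self, Nat.choose_zero_right, Nat.cast_one,
        mul_one] at hsum
      have hF : f p = (-1 : R) ^ p • (e p - ∑ i ∈ Finset.range p,
          ((-1 : R) ^ i * (Nat.choose (k - i) (p - i) : R)) • f i) := by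
        rw [hsum, add_sub_cancel_left, smul_smul, ← mul_pow, neg_one_mul, neg_neg, one_pow,
          one_smul]
      rw [hF]
      exact Submodule.smul_mem _ _ (Submodule.sub_mem _ (Submodule.subset_span ⟨p, rfl⟩)
        (Submodule.sum_mem _ fun i hi =>
          Submodule.smul_mem _ _ (ih i (Finset.mem_range.1 hi))))
    · rw [hf p hp]
      exact Submodule.zero_mem _

lemma span_ER_eq_span_weightedEsymm (n k : ℕ) :
    Submodule.span (QRing n) (Set.range fun p => ER n p k) =
      Submodule.span (QRing n) (Set.range (weightedEsymm (qWeight n)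
        (fun i => (1 - X i : PolyR n)) (initialSegment (n - 1) k))) := by
  have : weightedEsymm (qWeight n) (fun i => (1 - X i : PolyR n)) (initialSegment (n - 1) k) =
      fun p => FR n p k := funext fun p => (FR_eq_weightedEsymm n p k).symm
  rw [this]
  exact span_range_alternating_choose_sum (R := QRing n) (A := PolyR n) k
    (fun p => FR n p k) (fun p => ER n p k) (fun p hp => if_neg hp.not_ge)
    (fun p hp => if_neg hp.not_ge) fun p hp => if_pos hp

lemma Lmod_eq_prod_powSpan (n : ℕ) :
    Lmod n = ∏ i : Fin (n - 1), powSpan (QRing n) (X i : PolyR n) (n - 1 - i) := by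
  rw [prod_powSpan, Lmod]
  congr 1
  ext z
  refine exists_congr fun α => and_congr_left fun _ => ?_
  simp only [Finset.mem_univ, true_imp_iff]
  refine forall_congr' fun i => ?_
  have := i.2
  omega

lemma span_range_famE (n : ℕ) :
    Submodule.span (QRing n) (Set.range (famE n)) =
      ∏ i : Fin (n - 1), Submodule.span (QRing n) (Set.range fun p => ER n p ((i : ℕ) + 1)) := by
  rw [Submodule.prod_span]
  apply le_antisymm <;> rw [Submodule.span_le]
  · rintro _ ⟨p, rfl⟩
    exact Submodule.subset_span ((Set.mem_fintype_prod _ _).2 ⟨_, fun i => ⟨p i, rfl⟩, rfl⟩)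
  · intro z hz
    obtain ⟨g, hg, rfl⟩ := (Set.mem_fintype_prod _ _).1 hz
    choose p hp using hg
    by_cases h : ∀ i : Fin (n - 1), p i < (i : ℕ) + 2
    · exact Submodule.subset_span
        ⟨fun i => ⟨p i, h i⟩, Finset.prod_congr rfl fun i _ => hp i⟩
    · push Not at h
      obtain ⟨i, hi⟩ := h
      have : g i = 0 := by
        rw [← hp i]
        simp only [ER]
        rw [if_neg (by omega)]
      rw [Finset.prod_eq_zero (Finset.mem_univ i) this]
      exact Submodule.zero_mem _

theorem span_range_famE_eq_Lmod (n : ℕ) :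
    Submodule.span (QRing n) (Set.range (famE n)) = Lmod n := by
  have huniv : initialSegment (n - 1) (n - 1) = Finset.univ := by
    ext i
    simp [mem_initialSegment]
  have h := prod_span_weightedEsymm_initialSegment (isUnit_qWeight n)
    (fun i => (1 - X i : PolyR n)) le_rfl
  simp_rw [huniv, powSpan_one_sub] at h
  rw [span_range_famE, Lmod_eq_prod_powSpan, ← h]
  simp_rw [span_ER_eq_span_weightedEsymm]

/-- The monomials `x_1^{i_1}⋯x_{n−1}^{i_{n−1}}` with `0 ≤ i_j ≤ n−j`. -/
def boundedMonomial (n : ℕ) (α : (i : Fin (n - 1)) → Fin (n - (i : ℕ))) : PolyR n :=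
  ∏ i : Fin (n - 1), X i ^ (α i : ℕ)

lemma linearIndependent_boundedMonomial (n : ℕ) :
    LinearIndependent (QRing n) (boundedMonomial n) := by
  have h := (MvPolynomial.basisMonomials (Fin (n - 1)) (QRing n)).linearIndependent.comp
    (fun α : (i : Fin (n - 1)) → Fin (n - (i : ℕ)) =>
      Finsupp.equivFunOnFinite.symm fun i => (α i : ℕ)) (by
        intro α β hαβ
        ext i
        exact congrFun (Finsupp.equivFunOnFinite.symm.injective hαβ) i)
  have heq : boundedMonomial n = MvPolynomial.basisMonomials (Fin (n - 1)) (QRing n) ∘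
      fun α : (i : Fin (n - 1)) → Fin (n - (i : ℕ)) =>
        Finsupp.equivFunOnFinite.symm fun i => (α i : ℕ) := by
    funext α
    simp [boundedMonomial, MvPolynomial.monomial_eq, Finsupp.prod_fintype]
  rw [heq]
  exact h

lemma span_range_boundedMonomial (n : ℕ) :
    Submodule.span (QRing n) (Set.range (boundedMonomial n)) = Lmod n := by
  rw [Lmod]
  congr 1
  ext z
  constructor
  · rintro ⟨α, rfl⟩
    exact ⟨fun i => α i, fun i => by have := (α i).2; dsimp only; omega, rfl⟩
  · rintro ⟨α, hα, rfl⟩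
    exact ⟨fun i => ⟨α i, by have := hα i; omega⟩, rfl⟩

lemma finrank_Lmod (n : ℕ) :
    Module.finrank (QRing n) (Lmod n) =
      Fintype.card ((i : Fin (n - 1)) → Fin ((i : ℕ) + 2)) := by
  rw [← span_range_boundedMonomial, finrank_span_eq_card (linearIndependent_boundedMonomial n),
    Fintype.card_pi, Fintype.card_pi, ← Equiv.prod_comp Fin.revPerm]
  refine Finset.prod_congr rfl fun i _ => ?_
  simp only [Fintype.card_fin, Fin.revPerm_apply, Fin.val_rev]
  have := i.2
  omega

/-- The products `Ê_{p_1}^1·⋯·Ê_{p_{n−1}}^{n−1}` (`0 ≤ p_i ≤ i`) form an `R`-basis of the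
`R`-submodule `L_n^R`: they are linearly independent over `R` and span `L_n^R`. -/
theorem statement18 (n : ℕ) (hn : 1 ≤ n) :
    LinearIndependent (QRing n) (famE n) ∧
      Submodule.span (QRing n) (Set.range (famE n)) = Lmod n := by
  refine ⟨?_, span_range_famE_eq_Lmod n⟩
  rw [linearIndependent_iff_card_eq_finrank_span, Set.finrank, span_range_famE_eq_Lmod,
    finrank_Lmod]
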